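/- Every triple (α,β,γ) ∈ ℂ³ minimizing Φ over ℂ³ satisfies |α| < 2·|β|. (Lemma 1.1: the coefficients a = α and b = β = γ of the degree-one optimal polynomial approximant p₁(z₁,z₂) = a + b(z₁+z₂) to 1/f satisfy |a| < 2|b|, which forces a zero of p₁ on the diagonal of the open bidisk.) -/

import Mathlib

open Finset

/-- Maclaurin coefficients of `F(z) = (1 - √(2/3) z)^(-5/2)`. -/
noncomputable def a : ℕ → ℝ :=
  fun j => ∏ t ∈ Finset.Icc 1 j, (Real.sqrt (2 / 3) * (1 + 3 / (2 * (t : ℝ))))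

/-- Taylor coefficients of `f(z₁,z₂) = (1 - (z₁+z₂)/√6)^(-5/2)` at `z₁^k z₂^l`. -/
noncomputable def c : ℕ → ℕ → ℝ :=
  fun k l => a (k + l) * (Nat.choose (k + l) k : ℝ) / 2 ^ (k + l)

/-- Squared `H²(𝔻²)`-norm of `1 - (α + β z₁ + γ z₂) f`. -/
noncomputable def Φ : ℂ → ℂ → ℂ → ℝ :=
  fun α β γ =>
    ∑' p : ℕ × ℕ,
      ‖(if p = (0, 0) then (1 : ℂ) else 0)
        - α * (c p.1 p.2 : ℂ)
        - β * (if p.1 = 0 then (0 : ℂ) else (c (p.1 - 1) p.2 : ℂ))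
        - γ * (if p.2 = 0 then (0 : ℂ) else (c p.1 (p.2 - 1) : ℂ))‖ ^ 2


noncomputable def om (n : ℕ) : ℝ := (Nat.centralBinom n : ℝ) / 4 ^ n

lemma om_succ (n : ℕ) : om (n+1) = om n * ((2*n+1)/(2*n+2)) := by
  have h := Nat.succ_mul_centralBinom_succ n
  have h' : ((n:ℝ)+1) * (Nat.centralBinom (n+1) : ℝ) = 2*(2*n+1) * Nat.centralBinom n := by
    exact_mod_cast h
  have h2 : (Nat.centralBinom (n+1) : ℝ) = 2*(2*n+1) * Nat.centralBinom n / ((n:ℝ)+1) := by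
    rw [← h']; field_simp
  unfold om
  rw [h2]; field_simp; ring

lemma om_pos (n : ℕ) : 0 < om n := by
  unfold om; have := Nat.centralBinom_pos n; positivity

lemma om_le_one (n : ℕ) : om n ≤ 1 := by
  induction n with
  | zero => simp [om]
  | succ n ih =>
    rw [om_succ]
    have : ((2*n+1:ℝ)/(2*n+2)) ≤ 1 := by rw [div_le_one (by positivity)]; linarith
    exact mul_le_one₀ ih (by positivity) this

lemma a_succ (n : ℕ) : a (n+1) = a n * (Real.sqrt (2/3) * (1 + 3/(2*((n:ℝ)+1)))) := by
  unfold a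
  rw [Finset.prod_Icc_succ_top (by omega)]
  push_cast; rfl

lemma a_zero : a 0 = 1 := by simp [a]

lemma a_pos (n : ℕ) : 0 < a n := by
  induction n with
  | zero => simp [a_zero]
  | succ n ih => rw [a_succ]; positivity

lemma a_sq_succ (n : ℕ) : a (n+1)^2 = a n^2 * (2/3 * (1 + 3/(2*((n:ℝ)+1)))^2) := by
  rw [a_succ, mul_pow, mul_pow, Real.sq_sqrt (by norm_num)]

lemma a_sq_ratio (n : ℕ) (hn : 16 ≤ n) : a (n+1)^2 ≤ 4/5 * a n^2 := by
  rw [a_sq_succ, mul_comm]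
  have hn' : (16:ℝ) ≤ n := by exact_mod_cast hn
  have h1 : 3/(2*((n:ℝ)+1)) ≤ 3/34 := by
    apply div_le_div_of_nonneg_left <;> linarith
  have h0 : 0 ≤ 3/(2*((n:ℝ)+1)) := by positivity
  gcongr
  nlinarith

lemma summable_a_sq : Summable (fun n => a n^2) := by
  apply summable_of_ratio_norm_eventually_le (r := 4/5) (by norm_num)
  filter_upwards [Filter.eventually_ge_atTop 16] with n hn
  rw [Real.norm_of_nonneg (by positivity), Real.norm_of_nonneg (by positivity)]
  exact a_sq_ratio n hn

noncomputable def tt (n : ℕ) : ℝ := a n^2 * om (n+1)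

lemma tt_pos (n : ℕ) : 0 < tt n := mul_pos (pow_pos (a_pos n) 2) (om_pos _)

lemma tt_zero : tt 0 = 1/2 := by
  simp [tt, a_zero, om_succ]; simp [om]

lemma tt_succ (n : ℕ) : tt (n+1) = tt n * (2/3 * (1 + 3/(2*((n:ℝ)+1)))^2 * ((2*n+3)/(2*n+4))) := by
  unfold tt
  rw [a_sq_succ, om_succ (n+1)]; push_cast; ring

lemma tt_ratio (n : ℕ) (hn : 16 ≤ n) : tt (n+1) ≤ 4/5 * tt n := by
  unfold tt
  have h1 := a_sq_ratio n hn
  have h2 : om (n+1+1) ≤ om (n+1) := by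
    rw [om_succ (n+1)]
    apply mul_le_of_le_one_right (om_pos _).le
    rw [div_le_one (by positivity)]; linarith
  have := mul_le_mul h1 h2 (om_pos _).le (by positivity)
  linarith

lemma d_ge (n : ℕ) : tt n * (8164/10000 * (1 + 3/(2*((n:ℝ)+1))) - 1) ≤
    a n * a (n+1) * om (n+1) - a n^2 * om (n+1) := by
  have hs : (8164/10000 : ℝ) ≤ Real.sqrt (2/3) := by
    apply Real.le_sqrt_of_sq_le; norm_num
  have : a n * a (n+1) * om (n+1) - a n^2 * om (n+1) =
    tt n * (Real.sqrt (2/3) * (1 + 3/(2*((n:ℝ)+1))) - 1) := by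
    rw [a_succ, tt]; ring
  rw [this]
  have := tt_pos n
  gcongr

lemma partial_ge (N : ℕ) (hN : 16 ≤ N) : 1/10 + 92/100 * tt N ≤
    ∑ n ∈ range N, (a n * a (n+1) * om (n+1) - a n^2 * om (n+1)) := by
  induction N, hN using Nat.le_induction with
  | base =>
    refine le_trans ?_ (Finset.sum_le_sum (fun n _ => d_ge n))
    simp only [Finset.sum_range_succ, tt_succ, tt_zero, Finset.sum_range_zero]
    norm_num
  | succ N hN ih =>
    rw [Finset.sum_range_succ]
    have h1 := d_ge N
    have h2 := tt_ratio N hN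
    have h3 : 0 ≤ tt N * (3/(2*((N:ℝ)+1))) := by have := tt_pos N; positivity
    nlinarith [tt_pos N]

lemma pos_of_hasSum {s : ℝ} (h : HasSum (fun n => a n * a (n+1) * om (n+1) - a n^2 * om (n+1)) s) :
    0 < s := by
  have : (1/10:ℝ) ≤ s := by
    refine ge_of_tendsto h.tendsto_sum_nat ?_
    filter_upwards [Filter.eventually_ge_atTop 16] with N hN
    linarith [partial_ge N hN, tt_pos N]
  linarith

/-! antidiagonal sums -/

lemma vand (n : ℕ) : ∑ p ∈ antidiagonal n, c p.1 p.2 ^ 2 = a n^2 * om n := by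
  have h := Nat.add_choose_eq n n n
  have h2 : (Nat.centralBinom n : ℝ) = ∑ p ∈ antidiagonal n, (n.choose p.1 : ℝ) * n.choose p.2 := by
    rw [Nat.centralBinom, two_mul, h]; push_cast; rfl
  rw [om, h2, Finset.sum_div, Finset.mul_sum]
  refine Finset.sum_congr rfl fun p hp => ?_
  have hp' : p.1 + p.2 = n := by simpa using hp
  have e : n.choose p.2 = n.choose p.1 := by
    rw [← hp', Nat.choose_symm_add]
  rw [c, hp', e, show (4:ℝ) = 2^2 by norm_num, ← pow_mul, mul_comm 2 n, pow_mul]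
  field_simp

lemma vandC (n : ℕ) : ∑ p ∈ antidiagonal n, c p.1 p.2 * c (p.1+1) p.2 = a n * a (n+1) * om (n+1) := by
  have h := Nat.add_choose_eq (n+1) n (n+1)
  rw [Finset.Nat.antidiagonal_succ] at h
  simp only [Finset.sum_cons, Finset.sum_map] at h
  simp at h
  have h1 : Nat.centralBinom (n+1) = 2 * (n+1+n).choose (n+1) := by
    rw [Nat.centralBinom, show 2*(n+1) = (2*n+1)+1 by ring, Nat.choose_succ_succ,
      show n+1+n = 2*n+1 by ring]
    have := Nat.choose_symm_half n
    simp only [Nat.succ_eq_add_one] at *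
    omega
  have h2 : (Nat.centralBinom (n+1) : ℝ) = ∑ p ∈ antidiagonal n,
      2 * (((n+1).choose (p.1+1) : ℝ) * n.choose p.2) := by
    rw [h1, h]; push_cast; rw [Finset.mul_sum]
  rw [om, h2, Finset.sum_div, Finset.mul_sum]
  refine Finset.sum_congr rfl fun p hp => ?_
  have hp' : p.1 + p.2 = n := by simpa using hp
  have e : n.choose p.2 = n.choose p.1 := by
    rw [← hp', Nat.choose_symm_add]
  have hp2 : p.1 + 1 + p.2 = n + 1 := by omega
  rw [c, c, hp', hp2, e, show (4:ℝ) = 2^2 by norm_num, ← pow_mul, mul_comm 2 (n+1), pow_mul]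
  field_simp
  ring

lemma vandB (n : ℕ) : ∑ p ∈ antidiagonal n, c (p.1+1) p.2 * c p.1 (p.2+1) =
    2 * (a (n+1)^2 * om (n+2)) - a (n+1)^2 * om (n+1) := by
  have h := Nat.add_choose_eq (n+1) (n+1) (n+2)
  rw [Finset.Nat.antidiagonal_succ_succ'] at h
  simp only [Finset.sum_cons, Finset.sum_map] at h
  simp at h
  have h3 : ((n:ℝ)+2) * ((n+1+(n+1)).choose (n+2) : ℝ) = (n+1) * Nat.centralBinom (n+1) := by
    have := Nat.choose_succ_right_eq (2*(n+1)) (n+1)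
    rw [Nat.centralBinom, ← two_mul]
    rw [show 2*(n+1)-(n+1) = n+1 by omega] at this
    have h : (((2*(n+1)).choose (n+2) * (n+2) : ℕ) : ℝ) = ((2*(n+1)).choose (n+1) * (n+1) : ℕ) := by
      exact_mod_cast this
    push_cast at h
    linarith
  have h2 : ((n+1+(n+1)).choose (n+2) : ℝ) = ∑ p ∈ antidiagonal n,
      (((n+1).choose (p.1+1) : ℝ) * (n+1).choose (p.2+1)) := by
    rw [h]; push_cast; rfl
  have h4 : 2 * (a (n+1)^2 * om (n+2)) - a (n+1)^2 * om (n+1) =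
     a (n+1)^2 * (((n+1+(n+1)).choose (n+2) : ℝ) / 4^(n+1)) := by
    have h5 : ((n+1+(n+1)).choose (n+2) : ℝ) = (n+1) * Nat.centralBinom (n+1) / (n+2) := by
      rw [← h3]; field_simp
    rw [om_succ (n+1), h5, om]; push_cast; field_simp; ring
  rw [h4, h2, Finset.sum_div, Finset.mul_sum]
  refine Finset.sum_congr rfl fun p hp => ?_
  have hp' : p.1 + p.2 = n := by simpa using hp
  have e : (n+1).choose (p.2+1) = (n+1).choose p.1 := by
    rw [← hp', show p.1+p.2+1 = p.1 + (p.2+1) by ring, Nat.choose_symm_add]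
  have hp2 : p.1 + 1 + p.2 = n + 1 := by omega
  have hp3 : p.1 + (p.2 + 1) = n + 1 := by omega
  rw [c, c, hp2, hp3, e, show (4:ℝ) = 2^2 by norm_num, ← pow_mul, mul_comm 2 (n+1), pow_mul]
  field_simp

lemma c_pos (k l : ℕ) : 0 < c k l := by
  unfold c
  have := a_pos (k+l)
  have : 0 < (k+l).choose k := Nat.choose_pos (by omega)
  positivity

lemma summable_c_sq : Summable (fun p : ℕ × ℕ => c p.1 p.2 ^ 2) := by
  rw [← Finset.HasAntidiagonal.sigmaAntidiagonalEquivProd.summable_iff]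
  rw [summable_sigma_of_nonneg (fun _ => by simp only [Function.comp]; positivity)]
  refine ⟨fun n => (hasSum_fintype _).summable, ?_⟩
  refine Summable.of_nonneg_of_le (fun n => tsum_nonneg fun _ => by simp only [Function.comp]; positivity) (fun n => ?_) summable_a_sq
  rw [tsum_fintype]
  simp only [Function.comp, Finset.HasAntidiagonal.sigmaAntidiagonalEquivProd_apply]
  rw [Finset.univ_eq_attach, Finset.sum_attach (antidiagonal n) (fun p => c p.1 p.2 ^ 2), vand]
  exact mul_le_of_le_one_right (by positivity) (om_le_one n)

lemma hasSum_anti {f : ℕ × ℕ → ℝ} (hf : Summable f) :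
    HasSum (fun n => ∑ p ∈ antidiagonal n, f p) (∑' p, f p) := by
  have h := (Finset.HasAntidiagonal.sigmaAntidiagonalEquivProd.hasSum_iff.mpr hf.hasSum)
  have := h.sigma (fun n => hasSum_fintype _)
  convert this using 2 with n
  simp only [Function.comp, Finset.HasAntidiagonal.sigmaAntidiagonalEquivProd_apply]
  rw [Finset.univ_eq_attach, Finset.sum_attach (antidiagonal n) f]

/-- main inequality -/
lemma key (hC : Summable fun p : ℕ × ℕ => c p.1 p.2 * c (p.1+1) p.2)
    (hB : Summable fun p : ℕ × ℕ => c (p.1+1) p.2 * c p.1 (p.2+1)) :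
    (∑' p : ℕ × ℕ, c p.1 p.2 ^ 2) + (∑' p : ℕ × ℕ, c (p.1+1) p.2 * c p.1 (p.2+1)) <
      2 * ∑' p : ℕ × ℕ, c p.1 p.2 * c (p.1+1) p.2 := by
  have hA := hasSum_anti summable_c_sq
  have hC := hasSum_anti hC
  have hB := hasSum_anti hB
  simp only [vand, vandC, vandB] at hA hB hC
  have hB' : HasSum (fun n => 2 * (a n^2 * om (n+1)) - a n^2 * om n)
      (∑' p : ℕ × ℕ, c (p.1+1) p.2 * c p.1 (p.2+1)) := by
    rw [← hasSum_nat_add_iff' 1]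
    have e : 2 * (a 0^2 * om (0+1)) - a 0^2 * om 0 = 0 := by
      rw [om_succ]; norm_num; ring
    simpa [e] using hB
  have h := ((hC.mul_left 2).sub (hA.add hB')).mul_left (1/2)
  have := pos_of_hasSum (s := 1/2 * (2 * (∑' p : ℕ × ℕ, c p.1 p.2 * c (p.1+1) p.2) -
    ((∑' p : ℕ × ℕ, c p.1 p.2 ^ 2) + (∑' p : ℕ × ℕ, c (p.1+1) p.2 * c p.1 (p.2+1))))) (by
      refine h.congr_fun ?_
      intro n; ring)
  linarith

/-! Hilbert space part -/

lemma summable_mul_of_sq {v w : ℕ × ℕ → ℝ} (hv : Summable fun p => v p ^ 2)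
    (hw : Summable fun p => w p ^ 2) : Summable fun p => v p * w p := by
  refine Summable.of_norm_bounded (hv.add hw) fun p => ?_
  rw [Real.norm_eq_abs, abs_le]
  constructor <;> nlinarith [sq_nonneg (v p + w p), sq_nonneg (v p - w p)]

noncomputable def emb (v : ℕ × ℕ → ℝ) (hv : Summable fun p => v p ^ 2) :
    lp (fun _ : ℕ × ℕ => ℂ) 2 :=
  ⟨fun p => (v p : ℂ), memℓp_gen (by simpa using hv)⟩

lemma emb_apply (v : ℕ × ℕ → ℝ) (hv) (p) : emb v hv p = (v p : ℂ) := rfl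

lemma inner_emb (v w : ℕ × ℕ → ℝ) (hv hw) :
    inner ℂ (emb v hv) (emb w hw) = ((∑' p, v p * w p : ℝ) : ℂ) := by
  rw [lp.inner_eq_tsum, Complex.ofReal_tsum]
  refine tsum_congr fun p => ?_
  simp [emb_apply, mul_comm]

lemma orth {E : Type*} [NormedAddCommGroup E] [InnerProductSpace ℂ E] (u r : E)
    (h : ∀ z : ℂ, ‖r‖^2 ≤ ‖r - z • u‖^2) : inner ℂ u r = 0 := by
  by_cases hu : u = 0
  · simp [hu]
  have hu' : 0 < ‖u‖ := norm_pos_iff.mpr hu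
  have h1 := h (inner ℂ u r / (‖u‖^2 : ℝ))
  rw [@norm_sub_sq ℂ] at h1
  have e : inner ℂ r ((inner ℂ u r / (‖u‖^2 : ℝ)) • u) = ((‖inner ℂ u r‖^2 / ‖u‖^2 : ℝ) : ℂ) := by
    rw [inner_smul_right, ← inner_conj_symm r u, div_mul_eq_mul_div, Complex.mul_conj']
    push_cast; rfl
  rw [e, norm_smul, norm_div, mul_pow, div_pow, Complex.norm_real, Real.norm_of_nonneg (by positivity)] at h1
  simp only [RCLike.ofReal_re, Complex.coe_algebraMap, RCLike.re_to_complex, Complex.ofReal_re] at h1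
  have e2 : ‖inner ℂ u r‖^2 / (‖u‖^2)^2 * ‖u‖^2 = ‖inner ℂ u r‖^2 / ‖u‖^2 := by
    field_simp
  rw [e2] at h1
  have h2 : ‖inner ℂ u r‖^2 / ‖u‖^2 ≤ 0 := by linarith
  have h3 : ‖inner ℂ u r‖^2 ≤ 0 := by
    rw [div_le_iff₀ (by positivity)] at h2; linarith
  have h4 : ‖inner ℂ u r‖ = 0 := by
    have := sq_nonneg ‖inner ℂ u r‖
    exact pow_eq_zero_iff (two_ne_zero) |>.mp (le_antisymm h3 this)
  exact norm_eq_zero.mp h4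

noncomputable def v0 (p : ℕ × ℕ) : ℝ := if p = (0,0) then 1 else 0
noncomputable def v1 (p : ℕ × ℕ) : ℝ := c p.1 p.2
noncomputable def v2 (p : ℕ × ℕ) : ℝ := if p.1 = 0 then 0 else c (p.1-1) p.2
noncomputable def v3 (p : ℕ × ℕ) : ℝ := if p.2 = 0 then 0 else c p.1 (p.2-1)

lemma hasSum_shift1 {f : ℕ × ℕ → ℝ} {s : ℝ} (hf : ∀ l, f (0, l) = 0) :
    HasSum (fun p : ℕ × ℕ => f (p.1+1, p.2)) s ↔ HasSum f s := by
  refine Function.Injective.hasSum_iff (g := fun p : ℕ × ℕ => (p.1+1, p.2)) ?_ ?_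
  · rintro ⟨x, y⟩ ⟨x', y'⟩ h; simpa using h
  · rintro ⟨x, y⟩ h
    rcases x with _ | x
    · exact hf y
    · exact absurd ⟨(x, y), rfl⟩ h

lemma hasSum_shift2 {f : ℕ × ℕ → ℝ} {s : ℝ} (hf : ∀ l, f (l, 0) = 0) :
    HasSum (fun p : ℕ × ℕ => f (p.1, p.2+1)) s ↔ HasSum f s := by
  refine Function.Injective.hasSum_iff (g := fun p : ℕ × ℕ => (p.1, p.2+1)) ?_ ?_
  · rintro ⟨x, y⟩ ⟨x', y'⟩ h; simpa using h
  · rintro ⟨x, y⟩ h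
    rcases y with _ | y
    · exact hf x
    · exact absurd ⟨(x, y), rfl⟩ h

lemma c_symm (k l : ℕ) : c k l = c l k := by
  unfold c; rw [add_comm l k, ← Nat.choose_symm_add]

noncomputable def AA : ℝ := ∑' p, v1 p ^ 2
noncomputable def BB : ℝ := ∑' p, v2 p * v3 p
noncomputable def CC : ℝ := ∑' p, v1 p * v2 p

lemma s1 : Summable fun p => v1 p ^ 2 := summable_c_sq
lemma h22 : HasSum (fun p => v2 p ^ 2) AA := by
  rw [← hasSum_shift1 (by simp [v2])]
  simpa [v2, v1, AA] using s1.hasSum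
lemma h33 : HasSum (fun p => v3 p ^ 2) AA := by
  rw [← hasSum_shift2 (by simp [v3])]
  simpa [v3, v1, AA] using s1.hasSum
lemma s2 : Summable fun p => v2 p ^ 2 := h22.summable
lemma s3 : Summable fun p => v3 p ^ 2 := h33.summable
lemma s0 : Summable fun p => v0 p ^ 2 := by
  apply summable_of_ne_finset_zero (s := {(0,0)})
  intro p hp
  have : p ≠ (0,0) := by simpa using hp
  simp [v0, this]

lemma h12 : HasSum (fun p => v1 p * v2 p) CC := (summable_mul_of_sq s1 s2).hasSum
lemma h23 : HasSum (fun p => v2 p * v3 p) BB := (summable_mul_of_sq s2 s3).hasSum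
lemma h13 : HasSum (fun p => v1 p * v3 p) CC := by
  rw [← (Equiv.prodComm ℕ ℕ).hasSum_iff]
  convert h12 using 2 with p
  simp [v1, v2, v3, c_symm p.1, c_symm (p.1 - 1)]

lemma h10 : HasSum (fun p => v1 p * v0 p) 1 := by
  have := hasSum_single (f := fun p => v1 p * v0 p) (0,0) (fun p hp => by simp [v0, hp])
  convert this using 1
  simp [v1, v0, c, a_zero]

lemma h20 : (fun p => v2 p * v0 p) = fun _ => 0 := by
  ext ⟨k, l⟩; simp only [v2, v0, Prod.mk.injEq]; split_ifs <;> simp_all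
lemma h30 : (fun p => v3 p * v0 p) = fun _ => 0 := by
  ext ⟨k, l⟩; simp only [v3, v0, Prod.mk.injEq]; split_ifs <;> simp_all

lemma key2 : AA + BB < 2 * CC := by
  have hC : HasSum (fun p : ℕ × ℕ => c p.1 p.2 * c (p.1+1) p.2) CC := by
    have := (hasSum_shift1 (by simp [v2])).mpr h12
    simpa [v1, v2, mul_comm] using this
  have hB : HasSum (fun p : ℕ × ℕ => c (p.1+1) p.2 * c p.1 (p.2+1)) BB := by
    have := (hasSum_shift2 (by simp [v3])).mpr ((hasSum_shift1 (by simp [v2])).mpr h23)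
    simpa [v3, v2, mul_comm] using this
  have := key hC.summable hB.summable
  rwa [hC.tsum_eq, hB.tsum_eq] at this

lemma A_pos : 0 < AA := by
  refine s1.tsum_pos (fun p => sq_nonneg _) (0,0) ?_
  have := c_pos 0 0
  simp only [v1]; positivity

lemma B_nonneg : 0 ≤ BB := by
  refine tsum_nonneg fun p => ?_
  have h1 := (c_pos (p.1-1) p.2).le
  have h2 := (c_pos p.1 (p.2-1)).le
  unfold v2 v3; split_ifs <;> simp; positivity

lemma A_gt_B : BB < AA := by
  have h : HasSum (fun p => (v2 p - v3 p)^2) (AA + AA - 2 * BB) := by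
    refine ((h22.add h33).sub (h23.mul_left 2)).congr_fun ?_
    intro p; ring
  have : 0 < AA + AA - 2 * BB := by
    rw [← h.tsum_eq]
    refine h.summable.tsum_pos (fun p => sq_nonneg _) (1,0) ?_
    have := c_pos 0 0
    simp [v2, v3]; positivity
  linarith

lemma Phi_eq (α β γ : ℂ) : Φ α β γ =
    ‖emb v0 s0 - α • emb v1 s1 - β • emb v2 s2 - γ • emb v3 s3‖^2 := by
  have := lp.norm_rpow_eq_tsum (p := 2) (by norm_num)
    (emb v0 s0 - α • emb v1 s1 - β • emb v2 s2 - γ • emb v3 s3)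
  simp only [ENNReal.toReal_ofNat, Real.rpow_ofNat] at this
  rw [this, Φ]
  refine tsum_congr fun p => ?_
  simp only [lp.coeFn_sub, lp.coeFn_smul, Pi.sub_apply, Pi.smul_apply, emb_apply, smul_eq_mul,
    v0, v1, v2, v3]
  split_ifs <;> simp

/-- Lemma 1.1: every minimizer of `Φ` satisfies `|α| < 2|β|`. -/
theorem opa_coefficient_inequality :
    ∀ α β γ : ℂ, (∀ α' β' γ' : ℂ, Φ α β γ ≤ Φ α' β' γ') →
      ‖α‖ < 2 * ‖β‖ := by
  intro α β γ h
  simp only [Phi_eq] at h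
  have e1 := orth (emb v1 s1) _ (fun z => (h (α + z) β γ).trans_eq (by congr 2; module))
  have e2 := orth (emb v2 s2) _ (fun z => (h α (β + z) γ).trans_eq (by congr 2; module))
  have e3 := orth (emb v3 s3) _ (fun z => (h α β (γ + z)).trans_eq (by congr 2; module))
  have c21 : (∑' p, v2 p * v1 p) = CC := by simp_rw [mul_comm (v2 _)]; rfl
  have c31 : (∑' p, v3 p * v1 p) = CC := by simp_rw [mul_comm (v3 _)]; exact h13.tsum_eq
  have c32 : (∑' p, v3 p * v2 p) = BB := by simp_rw [mul_comm (v3 _)]; rfl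
  have c11 : (∑' p, v1 p * v1 p) = AA := by simp_rw [← sq]; rfl
  have c22 : (∑' p, v2 p * v2 p) = AA := by simp_rw [← sq]; exact h22.tsum_eq
  have c33 : (∑' p, v3 p * v3 p) = AA := by simp_rw [← sq]; exact h33.tsum_eq
  simp only [inner_sub_right, inner_smul_right, inner_emb, c21, c31, c32, c11, c22, c33,
    h12.tsum_eq, h13.tsum_eq, h23.tsum_eq, h10.tsum_eq, h20, h30] at e1 e2 e3
  simp only [tsum_zero, Complex.ofReal_zero, Complex.ofReal_one] at e1 e2 e3
  have hA := A_pos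
  have hB := B_nonneg
  have hAB := A_gt_B
  have hk := key2
  have hC : 0 < CC := by linarith
  have hne : ((AA:ℂ) - BB) ≠ 0 := by
    rw [← Complex.ofReal_sub]; exact_mod_cast (sub_pos.mpr hAB).ne'
  have hbg : β = γ := by
    have : (β - γ) * ((AA:ℂ) - BB) = 0 := by linear_combination e3 - e2
    rcases mul_eq_zero.mp this with h | h
    · exact sub_eq_zero.mp h
    · exact absurd h hne
  subst hbg
  have h1 : α * (CC:ℂ) = -(β * ((AA + BB : ℝ):ℂ)) := by
    push_cast; linear_combination -e2
  have h2 : ‖α‖ * CC = ‖β‖ * (AA + BB) := by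
    have := congrArg norm h1
    rwa [norm_neg, norm_mul, norm_mul, Complex.norm_real, Complex.norm_real,
      Real.norm_of_nonneg hC.le, Real.norm_of_nonneg (by linarith)] at this
  have hβ : 0 < ‖β‖ := by
    rw [norm_pos_iff]
    rintro rfl
    have h3 : α = 0 := by
      have : ‖α‖ * CC = 0 := by rw [h2]; simp
      rcases mul_eq_zero.mp this with h | h
      · exact norm_eq_zero.mp h
      · exact absurd h hC.ne'
    subst h3
    simp at e1
  have h4 : ‖α‖ * CC < 2 * ‖β‖ * CC := by
    rw [h2]; nlinarith
  exact lt_of_mul_lt_mul_right h4 hC.le
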